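/- Let S ≥ 1, ν ∈ ℤ, let f_μ : ℂ → ℂ (μ ∈ ℤ) be a family of functions, and let γ_1,…,γ_S, β_1,…,β_S be complex numbers with γ_ℓ ≠ β_j for all ℓ, j, such that every point y among the γ's and β's satisfies y·f_μ(y) = (μ − 1)·f_{μ−1}(y) − f_{μ−2}(y) for all μ ∈ ℤ. Set g := f_{ν−1} − (ν/2) f_ν, write x = (x_1,…,x_{2S}) := (γ_1,…,γ_S, β_1,…,β_S), and for a tuple v of length m set Δ(v) := ∏_{1≤j<k≤m}(v_j − v_k). Then Δ(x) · det[ ( f_ν(γ_ℓ) g(β_j) − g(γ_ℓ) f_ν(β_j) ) / (γ_ℓ − β_j) ]_{ℓ,j=1}^S = Δ(γ) Δ(β) · det[ f_{ν−ℓ+1}(x_j) ]_{ℓ=1,…,2S; j=1,…,2S}. -/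

import Mathlib

open Finset

/-- The Vandermonde-type product `Δ(v) = ∏_{j<k} (v_j - v_k)`. -/
noncomputable def vdmC {m : ℕ} (v : Fin m → ℂ) : ℂ :=
  ∏ p ∈ Finset.univ.filter (fun p : Fin m × Fin m => p.1 < p.2), (v p.1 - v p.2)

open Matrix Polynomial in
/-- A `2 × 2` block determinant whose left blocks are diagonal. -/
lemma det_fromBlocks_diagonal_left {R n : Type*} [CommRing R] [Fintype n] [DecidableEq n]
    (a b : n → R) (P Q : Matrix n n R) :
    (fromBlocks (diagonal a) P (diagonal b) Q).det = (diagonal a * Q - diagonal b * P).det := by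
  have key : ∀ {R : Type _} [CommRing R] (a b : n → R) (P Q : Matrix n n R),
      (∏ i, a i) * (fromBlocks (diagonal a) P (diagonal b) Q).det
        = (∏ i, a i) * (diagonal a * Q - diagonal b * P).det := by
    intro R _ a b P Q
    have h : fromBlocks 1 0 (-diagonal b) (diagonal a) * fromBlocks (diagonal a) P (diagonal b) Q
        = fromBlocks (diagonal a) P 0 (diagonal a * Q - diagonal b * P) := by
      rw [fromBlocks_multiply]
      congr 1
      · simp
      · simp
      · simp [mul_comm]
      · rw [Matrix.neg_mul, ← sub_eq_neg_add]
    have := congrArg det h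
    simpa [det_mul, det_fromBlocks_zero₁₂, det_fromBlocks_zero₂₁, det_diagonal] using this
  have hreg : (∏ i, (X + C (a i))).Monic := monic_prod_of_monic _ _ fun i _ => monic_X_add_C _
  have h := hreg.isRegular.left (key (fun i => X + C (a i)) (fun i => C (b i)) (P.map C) (Q.map C))
  have h0 := congrArg (evalRingHom (0 : R)) h
  have hC : ∀ M : Matrix n n R, (M.map C).map (evalRingHom (0 : R)) = M := by
    intro M; ext; simp
  simp only [RingHom.map_det, RingHom.mapMatrix_apply, fromBlocks_map, Matrix.map_sub _ (map_sub _),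
    Matrix.map_mul, hC, diagonal_map (map_zero _)] at h0
  simpa [Function.comp_def] using h0

lemma vdmC_eq_prod_prod {m : ℕ} (v : Fin m → ℂ) :
    vdmC v = ∏ i, ∏ j, if i < j then v i - v j else 1 := by
  rw [vdmC, Finset.prod_filter, Fintype.prod_prod_type]

lemma vdmC_append {m n : ℕ} (γ : Fin m → ℂ) (β : Fin n → ℂ) :
    vdmC (Fin.append γ β) = vdmC γ * vdmC β * ∏ i, ∏ j, (γ i - β j) := by
  have h1 : ∀ (i : Fin m) (j : Fin n), Fin.castAdd n i < Fin.natAdd m j := by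
    intro i j; simp only [Fin.lt_def, Fin.val_castAdd, Fin.val_natAdd]; omega
  have h2 : ∀ (i : Fin m) (j : Fin n), ¬ Fin.natAdd m j < Fin.castAdd n i := by
    intro i j; exact (h1 i j).asymm
  have h3 : ∀ i j : Fin m, Fin.castAdd n i < Fin.castAdd n j ↔ i < j :=
    fun _ _ => Iff.rfl
  have h4 : ∀ i j : Fin n, Fin.natAdd m i < Fin.natAdd m j ↔ i < j := by
    intro i j; simp only [Fin.lt_def, Fin.val_natAdd]; omega
  simp only [vdmC_eq_prod_prod, Fin.prod_univ_add, Fin.append_left, Fin.append_right, h1, h2, h3,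
    h4, if_true, if_false, Finset.prod_mul_distrib, Finset.prod_const_one]
  ring

lemma vdmC_eq_zero {m : ℕ} {v : Fin m → ℂ} (hv : ¬ Function.Injective v) : vdmC v = 0 := by
  simp only [Function.Injective, not_forall] at hv
  obtain ⟨i, j, hij, hne⟩ := hv
  rcases lt_or_gt_of_ne hne with h | h
  · exact Finset.prod_eq_zero (i := (i, j)) (by simp [h]) (by simp [hij])
  · exact Finset.prod_eq_zero (i := (j, i)) (by simp [h]) (by simp [hij])

/-- The sign `(-1) ^ (m.choose 2)`, as a product over the pairs `i < j` in `Fin m`. -/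
def pairSign (m : ℕ) : ℤ := ∏ i : Fin m, ∏ j : Fin m, if i < j then -1 else 1

lemma pairSign_mul_self (m : ℕ) : pairSign m * pairSign m = 1 := by
  simp only [pairSign, ← Finset.prod_mul_distrib]
  exact Finset.prod_eq_one fun i _ => Finset.prod_eq_one fun j _ => by split_ifs <;> rfl

lemma det_vandermonde_eq_pairSign_mul_vdmC {m : ℕ} (v : Fin m → ℂ) :
    (Matrix.vandermonde v).det = pairSign m * vdmC v := by
  simp only [Matrix.det_vandermonde, vdmC_eq_prod_prod, pairSign, Int.cast_prod,
    ← Finset.prod_mul_distrib]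
  refine Finset.prod_congr rfl fun i _ => ?_
  rw [← Finset.filter_lt_eq_Ioi, Finset.prod_filter]
  refine Finset.prod_congr rfl fun j _ => ?_
  split_ifs <;> simp

lemma prod_prod_erase_sub {m : ℕ} (v : Fin m → ℂ) :
    ∏ i, ∏ j ∈ univ.erase i, (v i - v j) = pairSign m * vdmC v ^ 2 := by
  have h : ∀ i, ∏ j ∈ univ.erase i, (v i - v j) =
      ∏ j, ((if i < j then v i - v j else 1) * (if j < i then v i - v j else 1)) := by
    intro i
    rw [← Finset.mul_prod_erase univ _ (Finset.mem_univ i)]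
    simp only [lt_irrefl, if_false, one_mul]
    refine Finset.prod_congr rfl fun j hj => ?_
    rcases lt_or_gt_of_ne (Finset.ne_of_mem_erase hj) with h | h <;> simp [h, h.asymm]
  simp only [h, Finset.prod_mul_distrib]
  rw [← vdmC_eq_prod_prod, Finset.prod_comm (f := fun i j => if j < i then v i - v j else 1)]
  have h2 : (∏ j, ∏ i, if j < i then v i - v j else 1) = pairSign m * vdmC v := by
    simp only [vdmC_eq_prod_prod, pairSign, Int.cast_prod, ← Finset.prod_mul_distrib]
    refine Finset.prod_congr rfl fun i _ => Finset.prod_congr rfl fun j _ => ?_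
    split_ifs <;> simp
  rw [h2]; ring

open Polynomial in
lemma sum_pow_mul_eval_basis {m : ℕ} {γ : Fin m → ℂ} (hγ : Function.Injective γ) (k : Fin m)
    (y : ℂ) : ∑ l, γ l ^ (k : ℕ) * (Lagrange.basis univ γ l).eval y = y ^ (k : ℕ) := by
  have h := Lagrange.eq_interpolate (s := univ) (v := γ) (f := (X : ℂ[X]) ^ (k : ℕ)) hγ.injOn
    (by simp)
  have heval := congrArg (eval y) h
  simp only [Lagrange.interpolate_apply, eval_finsetSum, eval_mul, eval_C, eval_pow, eval_X] at heval
  exact heval.symm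

open Polynomial in
lemma eval_basis_eq_div {m : ℕ} (γ : Fin m → ℂ) (l : Fin m) {y : ℂ} (hy : γ l ≠ y) :
    (Lagrange.basis univ γ l).eval y
      = (∏ k ∈ univ.erase l, (γ l - γ k))⁻¹ * (-(∏ k, (y - γ k)) * (γ l - y)⁻¹) := by
  have h : γ l - y ≠ 0 := sub_ne_zero.2 hy
  rw [Lagrange.basis, eval_prod, ← Finset.mul_prod_erase univ _ (Finset.mem_univ l)]
  simp only [Lagrange.basisDivisor, eval_mul, eval_C, eval_sub, eval_X, Finset.prod_mul_distrib,
    Finset.prod_inv_distrib]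
  field_simp
  ring

lemma prod_neg_prod_sub {m : ℕ} (γ β : Fin m → ℂ) :
    ∏ j, -∏ k, (β j - γ k) = ∏ i, ∏ j, (γ i - β j) := by
  have h : ∀ j, -∏ k, (β j - γ k) = (-1) ^ (m + 1) * ∏ k, (γ k - β j) := by
    intro j
    have : ∏ k, (β j - γ k) = (-1) ^ m * ∏ k, (γ k - β j) := by
      simp_rw [← neg_sub (γ _) (β j), Finset.prod_neg]
      simp
    rw [this]; ring
  simp only [h, Finset.prod_mul_distrib, Finset.prod_const, Finset.card_univ, Fintype.card_fin]
  rw [← pow_mul, mul_comm (m + 1) m, (Nat.even_mul_succ_self m).neg_one_pow, one_mul,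
    Finset.prod_comm]

/-- The `2m × 2m` matrix with rows `y ^ k * a y`, then `y ^ k * b y`, and columns indexed by the
points `y` among the `γ`, then the `β`. -/
def doubleVandermonde {m : ℕ} (a b : ℂ → ℂ) (γ β : Fin m → ℂ) :
    Matrix (Fin m ⊕ Fin m) (Fin m ⊕ Fin m) ℂ :=
  Matrix.fromBlocks
    (Matrix.of fun k l => γ l ^ (k : ℕ) * a (γ l)) (Matrix.of fun k j => β j ^ (k : ℕ) * a (β j))
    (Matrix.of fun k l => γ l ^ (k : ℕ) * b (γ l)) (Matrix.of fun k j => β j ^ (k : ℕ) * b (β j))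

open Matrix in
lemma det_doubleVandermonde {m : ℕ} (a b : ℂ → ℂ) {γ β : Fin m → ℂ} (hγ : Function.Injective γ)
    (hd : ∀ l j, γ l ≠ β j) :
    (doubleVandermonde a b γ β).det = pairSign m * (∏ i, ∏ j, (γ i - β j)) *
      (of fun l j => (a (γ l) * b (β j) - b (γ l) * a (β j)) / (γ l - β j)).det := by
  set V := (vandermonde γ)ᵀ with hV
  set W : Matrix (Fin m) (Fin m) ℂ := of fun l j => (Lagrange.basis univ γ l).eval (β j) with hW
  have hVW : ∀ k j, (V * W) k j = β j ^ (k : ℕ) := fun k j => by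
    simp [mul_apply, hV, hW, vandermonde_apply, sum_pow_mul_eval_basis hγ]
  have hfac : doubleVandermonde a b γ β = fromBlocks V 0 0 V *
      fromBlocks (diagonal (a ∘ γ)) (W * diagonal (a ∘ β))
        (diagonal (b ∘ γ)) (W * diagonal (b ∘ β)) := by
    rw [fromBlocks_multiply, doubleVandermonde]
    congr 1 <;> ext k j <;>
      simp [← Matrix.mul_assoc, mul_diagonal, hVW]
    all_goals simp [hV, vandermonde_apply]
  have hdiff : diagonal (a ∘ γ) * (W * diagonal (b ∘ β)) - diagonal (b ∘ γ) * (W * diagonal (a ∘ β))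
      = of fun l j => (∏ k ∈ univ.erase l, (γ l - γ k))⁻¹ *
        (of fun l j => (-∏ k, (β j - γ k)) *
          (of fun l j => (a (γ l) * b (β j) - b (γ l) * a (β j)) / (γ l - β j)) l j) l j := by
    ext l j
    simp only [Matrix.sub_apply, diagonal_mul, mul_diagonal, hW, of_apply, Function.comp_apply,
      eval_basis_eq_div γ l (hd l j)]
    ring
  have hvdm : vdmC γ ≠ 0 := by
    have := (det_vandermonde_ne_zero_iff (v := γ)).2 hγ
    rw [det_vandermonde_eq_pairSign_mul_vdmC] at this
    exact right_ne_zero_of_mul this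
  have hs : (pairSign m : ℂ) * pairSign m = 1 := by exact_mod_cast pairSign_mul_self m
  have hs0 : (pairSign m : ℂ) ≠ 0 := left_ne_zero_of_mul_eq_one hs
  rw [hfac, det_mul, det_fromBlocks_zero₂₁, det_fromBlocks_diagonal_left, hdiff, det_mul_column,
    det_mul_row, prod_neg_prod_sub, Finset.prod_inv_distrib, prod_prod_erase_sub, hV,
    det_transpose, det_vandermonde_eq_pairSign_mul_vdmC]
  field_simp

/-- The equivalence `Fin m ⊕ Fin m ≃ Fin (m + m)` sending the two summands to the even and the odd
numbers. -/
def interleave (m : ℕ) : Fin m ⊕ Fin m ≃ Fin (m + m) where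
  toFun := Sum.elim (fun k => ⟨2 * k, by omega⟩) (fun k => ⟨2 * k + 1, by omega⟩)
  invFun i := if (i : ℕ) % 2 = 0 then .inl ⟨i / 2, by omega⟩ else .inr ⟨i / 2, by omega⟩
  left_inv := by
    rintro (k | k)
    · simp
    · have : (2 * (k : ℕ) + 1) / 2 = k := by omega
      simp [Nat.add_mod, this]
  right_inv i := by
    by_cases h : (i : ℕ) % 2 = 0 <;> ext <;> simp only [h, if_true, if_false, Sum.elim_inl,
      Sum.elim_inr] <;> omega

lemma sign_interleave (m : ℕ) :
    (Equiv.Perm.sign (finSumFinEquiv.symm.trans (interleave m)) : ℤ) = pairSign m := by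
  have h1 : ∀ i j : Fin m, Fin.castAdd m i < Fin.natAdd m j := by
    intro i j; simp only [Fin.lt_def, Fin.val_castAdd, Fin.val_natAdd]; omega
  have h2 : ∀ i j : Fin m, ¬ Fin.natAdd m j < Fin.castAdd m i := fun i j => (h1 i j).asymm
  have h3 : ∀ i j : Fin m, Fin.castAdd m i < Fin.castAdd m j ↔ i < j :=
    fun _ _ => Iff.rfl
  have h4 : ∀ i j : Fin m, Fin.natAdd m i < Fin.natAdd m j ↔ i < j := by
    intro i j; simp only [Fin.lt_def, Fin.val_natAdd]; omega
  have g1 : ∀ i j : Fin m, interleave m (.inl i) < interleave m (.inr j) ↔ ¬ j < i := by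
    intro i j; simp only [interleave, Equiv.coe_fn_mk, Sum.elim_inl, Sum.elim_inr, Fin.lt_def]
    omega
  have g3 : ∀ i j : Fin m, interleave m (.inl i) < interleave m (.inl j) ↔ i < j := by
    intro i j; simp only [interleave, Equiv.coe_fn_mk, Sum.elim_inl, Fin.lt_def]
    omega
  have g4 : ∀ i j : Fin m, interleave m (.inr i) < interleave m (.inr j) ↔ i < j := by
    intro i j; simp only [interleave, Equiv.coe_fn_mk, Sum.elim_inr, Fin.lt_def]
    omega
  have hone : ∀ i j : Fin m, (if i < j then (if i < j then (1 : ℤ) else -1) else 1) = 1 := by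
    intro i j; split_ifs <;> rfl
  rw [Equiv.Perm.sign_eq_prod_prod_Ioi]
  simp only [← Finset.filter_lt_eq_Ioi, Finset.prod_filter, Fin.prod_univ_add, Units.coe_prod,
    Units.val_mul, apply_ite Units.val, Units.val_one, Units.val_neg, h1, h2, h3, h4,
    Equiv.trans_apply, finSumFinEquiv_symm_apply_castAdd, finSumFinEquiv_symm_apply_natAdd,
    g1, g3, g4, hone, if_true, if_false, Finset.prod_const_one, one_mul, mul_one, ite_not]
  rw [pairSign, Finset.prod_comm]

/-- Iterating `y f_μ = (μ - 1) f_{μ-1} - f_{μ-2}` expresses `f_{ν-n}` through the functions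
`y ^ (i / 2) * f_{ν - i % 2}` with `i ≤ n`, with coefficients independent of `f` and `y`. -/
def recCoeff (ν : ℤ) : ℕ → ℕ → ℂ
  | 0, i => if i = 0 then 1 else 0
  | 1, i => if i = 1 then 1 else 0
  | n + 2, i => ((ν : ℂ) - n - 1) * recCoeff ν (n + 1) i -
      if 2 ≤ i then recCoeff ν n (i - 2) else 0

lemma recCoeff_eq_zero (ν : ℤ) : ∀ {n i : ℕ}, n < i → recCoeff ν n i = 0
  | 0, i, h => by simp [recCoeff, h.ne']
  | 1, i, h => by simp [recCoeff, h.ne']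
  | n + 2, i, h => by
    rw [recCoeff, recCoeff_eq_zero ν (show n + 1 < i by omega),
      recCoeff_eq_zero ν (show n < i - 2 by omega)]
    simp

lemma recCoeff_self (ν : ℤ) : ∀ n : ℕ, recCoeff ν n n = (-1) ^ (n / 2)
  | 0 => by simp [recCoeff]
  | 1 => by simp [recCoeff]
  | n + 2 => by
    rw [recCoeff, recCoeff_eq_zero ν (Nat.lt_succ_self (n + 1)), if_pos (by omega),
      Nat.add_sub_cancel, recCoeff_self ν n, Nat.add_div_right n two_pos, pow_succ]
    ring

lemma eq_sum_recCoeff {ν : ℤ} {F : ℤ → ℂ} {y : ℂ}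
    (h : ∀ μ : ℤ, y * F μ = ((μ : ℂ) - 1) * F (μ - 1) - F (μ - 2)) :
    ∀ {n N : ℕ}, n < N → F (ν - n) =
      ∑ i ∈ range N, recCoeff ν n i * (y ^ (i / 2) * F (ν - (i % 2 : ℕ)))
  | 0, N, hN => by
    rw [Finset.sum_eq_single_of_mem 0 (by simpa using hN)] <;> simp +contextual [recCoeff]
  | 1, N, hN => by
    rw [Finset.sum_eq_single_of_mem 1 (by simpa using hN)] <;> simp +contextual [recCoeff]
  | n + 2, N, hN => by
    obtain ⟨M, rfl⟩ : ∃ M, N = M + 2 := ⟨N - 2, by omega⟩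
    have h0 := eq_sum_recCoeff (ν := ν) h (show n < M by omega)
    have h1 := eq_sum_recCoeff (ν := ν) h (show n + 1 < M + 2 by omega)
    have hr := h (ν - n)
    have e1 : ν - (n : ℤ) - 1 = ν - ((n + 1 : ℕ) : ℤ) := by push_cast; ring
    have e2 : ν - (n : ℤ) - 2 = ν - ((n + 2 : ℕ) : ℤ) := by push_cast; ring
    rw [e1, e2] at hr
    have hF : F (ν - ((n + 2 : ℕ) : ℤ))
        = ((ν : ℂ) - n - 1) * F (ν - ((n + 1 : ℕ) : ℤ)) - y * F (ν - n) := by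
      push_cast at hr ⊢
      linear_combination hr
    rw [hF, h0, h1]
    simp only [recCoeff, sub_mul, Finset.sum_sub_distrib]
    congr 1
    · simp only [Finset.mul_sum, mul_assoc]
    · rw [Finset.sum_range_succ', Finset.sum_range_succ', Finset.mul_sum]
      simp only [add_assoc, Nat.reduceAdd, le_add_iff_nonneg_left, zero_le, if_true,
        Nat.add_sub_cancel, Nat.add_div_right _ two_pos, Nat.add_mod_right, pow_succ]
      simp only [Nat.not_ofNat_le_one, nonpos_iff_eq_zero, OfNat.ofNat_ne_zero, if_false, zero_mul,
        add_zero]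
      exact Finset.sum_congr rfl fun i _ => by ring

lemma prod_neg_one_pow_half (m : ℕ) : ∏ i : Fin (m + m), (-1 : ℂ) ^ ((i : ℕ) / 2) = 1 := by
  rw [Fin.prod_univ_eq_prod_range (fun i => (-1 : ℂ) ^ (i / 2))]
  induction m with
  | zero => simp
  | succ m ih =>
    rw [show m + 1 + (m + 1) = m + m + 1 + 1 by ring, Finset.prod_range_succ,
      Finset.prod_range_succ, ih, show (m + m) / 2 = m by omega,
      show (m + m + 1) / 2 = m by omega, one_mul, ← pow_add, (Even.add_self m).neg_one_pow]

open Matrix in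
lemma det_shifted_eq_det_doubleVandermonde {m : ℕ} (ν : ℤ) (f : ℤ → ℂ → ℂ) (γ β : Fin m → ℂ)
    (hrec : ∀ (μ : ℤ) (j : Fin (m + m)),
      Fin.append γ β j * f μ (Fin.append γ β j)
        = ((μ : ℂ) - 1) * f (μ - 1) (Fin.append γ β j) - f (μ - 2) (Fin.append γ β j)) :
    (of fun l j : Fin (m + m) => f (ν - (l : ℕ)) (Fin.append γ β j)).det
      = pairSign m * (doubleVandermonde (f ν) (f (ν - 1)) γ β).det := by
  set x := Fin.append γ β with hx
  set T : Matrix (Fin (m + m)) (Fin (m + m)) ℂ := of fun n i => recCoeff ν n i with hT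
  set G : Matrix (Fin (m + m)) (Fin (m + m)) ℂ :=
    of fun i j => x j ^ ((i : ℕ) / 2) * f (ν - ((i : ℕ) % 2 : ℕ)) (x j) with hG
  have hfac : (of fun l j : Fin (m + m) => f (ν - (l : ℕ)) (x j)) = T * G := by
    ext n j
    rw [mul_apply, of_apply,
      eq_sum_recCoeff (ν := ν) (F := fun μ => f μ (x j)) (fun μ => hrec μ j) n.isLt,
      ← Fin.sum_univ_eq_sum_range
        (fun i => recCoeff ν n i * (x j ^ (i / 2) * f (ν - (i % 2 : ℕ)) (x j)))]
    rfl
  have hdetT : T.det = 1 := by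
    rw [det_of_isLowerTriangular T fun i j hij => recCoeff_eq_zero ν hij]
    simp only [hT, of_apply, recCoeff_self, prod_neg_one_pow_half]
  have hperm : doubleVandermonde (f ν) (f (ν - 1)) γ β
      = (G.submatrix (finSumFinEquiv.symm.trans (interleave m)) id).submatrix
          finSumFinEquiv finSumFinEquiv := by
    have h : ∀ k : ℕ, (2 * k + 1) / 2 = k := by omega
    ext (k | k) (j | j) <;>
      simp [doubleVandermonde, hG, hx, interleave, h, -Fin.natAdd_eq_addNat]
  have hs : (pairSign m : ℂ) * pairSign m = 1 := by exact_mod_cast pairSign_mul_self m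
  rw [hfac, det_mul, hdetT, hperm, det_submatrix_equiv_self, det_permute, sign_interleave,
    ← mul_assoc, hs]

/-- the hard-edge kernel identity — the determinant built from the
Bessel-type Christoffel–Darboux kernel equals, after clearing Vandermonde factors,
the determinant of the shifted functions `f_{ν-ℓ+1}` (proof of Theorem 1.2). -/
theorem stmt_16 (S : ℕ) (hS : 1 ≤ S) (ν : ℤ) (f : ℤ → ℂ → ℂ)
    (γ β : Fin S → ℂ) (hd : ∀ ℓ j, γ ℓ ≠ β j)
    (hrec : ∀ (μ : ℤ) (j : Fin (S + S)),
      Fin.append γ β j * f μ (Fin.append γ β j)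
        = ((μ : ℂ) - 1) * f (μ - 1) (Fin.append γ β j) - f (μ - 2) (Fin.append γ β j)) :
    vdmC (Fin.append γ β) *
      Matrix.det (Matrix.of fun ℓ j : Fin S =>
        (f ν (γ ℓ) * (f (ν - 1) (β j) - ((ν : ℂ) / 2) * f ν (β j)) -
          (f (ν - 1) (γ ℓ) - ((ν : ℂ) / 2) * f ν (γ ℓ)) * f ν (β j)) / (γ ℓ - β j))
    = vdmC γ * vdmC β *
      Matrix.det (Matrix.of fun ℓ j : Fin (S + S) =>
        f (ν - (ℓ : ℕ)) (Fin.append γ β j)) := by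
  by_cases hγ : Function.Injective γ
  · have hs : (pairSign S : ℂ) * pairSign S = 1 := by exact_mod_cast pairSign_mul_self S
    have hK : (Matrix.of fun ℓ j : Fin S =>
        (f ν (γ ℓ) * (f (ν - 1) (β j) - ((ν : ℂ) / 2) * f ν (β j)) -
          (f (ν - 1) (γ ℓ) - ((ν : ℂ) / 2) * f ν (γ ℓ)) * f ν (β j)) / (γ ℓ - β j))
        = Matrix.of fun ℓ j =>
          (f ν (γ ℓ) * f (ν - 1) (β j) - f (ν - 1) (γ ℓ) * f ν (β j)) / (γ ℓ - β j) := by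
      ext ℓ j
      simp only [Matrix.of_apply]
      ring
    rw [det_shifted_eq_det_doubleVandermonde ν f γ β hrec, det_doubleVandermonde _ _ hγ hd,
      vdmC_append, hK, ← mul_assoc (pairSign S : ℂ), ← mul_assoc (pairSign S : ℂ), hs]
    ring
  · simp [vdmC_append, vdmC_eq_zero hγ]
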